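/- arXiv:2111.13206 — 2 statements merged into one kernel-verified Lean document; each statement's English description precedes it below -/
import Mathlib

section
/- Let (X_t : t ∈ ℝ) be a zero-mean stationary Gaussian process with continuous paths and covariance kernel R(t) = ∫ e^{itx} μ(dx), where μ is a finite non-null symmetric measure on ℝ with ∫ x² μ(dx) < ∞ and μ(ℝ \ {0}) > 0. Then τ_u^+ = inf{t ≥ 0 : X_t ≤ u} and τ_u^- = sup{t ≤ 0 : X_t ≤ u} converge to 0 in probability, conditionally on [X_0 > u], as u → ∞; that is, for every η > 0, P(τ_u^+ > η | X_0 > u) → 0 and P(τ_u^- < −η | X_0 > u) → 0. -/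
open MeasureTheory ProbabilityTheory Filter

/-- A real-valued stochastic process is a (zero-mean) Gaussian process if every finite
linear combination of its values has a centered Gaussian distribution. -/
def IsZeroMeanGaussianProcess {Ω : Type*} [MeasurableSpace Ω] (P : Measure Ω)
    (X : ℝ → Ω → ℝ) : Prop :=
  (∀ t, Measurable (X t)) ∧
  ∀ (n : ℕ) (t : Fin n → ℝ) (c : Fin n → ℝ),
    ∃ v : NNReal, P.map (fun ω => ∑ i, c i * X (t i) ω) = gaussianReal 0 v

lemma hasSubgaussianMGF_id_gaussianReal {v w : NNReal} (h : v ≤ w) :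
    HasSubgaussianMGF id w (gaussianReal 0 v) where
  integrable_exp_mul t := integrable_exp_mul_gaussianReal t
  mgf_le t := by
    rw [mgf_id_gaussianReal]
    have : (v : ℝ) ≤ w := h
    simp only [zero_mul, zero_add]
    gcongr

lemma gaussianReal_Ici_le {v w : NNReal} (h : v ≤ w) {u : ℝ} (hu : 0 ≤ u) :
    gaussianReal 0 v (Set.Ici u) ≤ ENNReal.ofReal (Real.exp (-u ^ 2 / (2 * w))) := by
  have := (hasSubgaussianMGF_id_gaussianReal h).measure_ge_le hu
  rw [ENNReal.le_ofReal_iff_toReal_le (measure_ne_top _ _) (Real.exp_pos _).le]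
  exact this

lemma le_gaussianReal_Ioi {v : NNReal} (hv : v ≠ 0) {u : ℝ} (hu : 0 ≤ u) :
    ENNReal.ofReal ((√(2 * Real.pi * v))⁻¹ * Real.exp (-(u + 1) ^ 2 / (2 * v)))
      ≤ gaussianReal 0 v (Set.Ioi u) := by
  calc _ = ∫⁻ _ in Set.Ioc u (u + 1),
        ENNReal.ofReal ((√(2 * Real.pi * v))⁻¹ * Real.exp (-(u + 1) ^ 2 / (2 * v))) := by simp
    _ ≤ ∫⁻ x in Set.Ioc u (u + 1), gaussianPDF 0 v x := by
        refine setLIntegral_mono (measurable_gaussianPDF 0 v) fun x hx => ?_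
        rw [gaussianPDF, gaussianPDFReal, sub_zero]
        have : x ^ 2 ≤ (u + 1) ^ 2 := pow_le_pow_left₀ (hu.trans hx.1.le) hx.2 2
        gcongr
    _ = gaussianReal 0 v (Set.Ioc u (u + 1)) := (gaussianReal_apply 0 hv _).symm
    _ ≤ _ := measure_mono Set.Ioc_subset_Ioi_self

/-- If `U` and `U + V` are centered Gaussian and the variance of `(U + V) / 2` is smaller than that
of `U`, then `V` is unlikely to exceed a high level exceeded by `U`. -/
lemma tendsto_cond_gt_of_gaussianReal {Ω : Type*} [MeasurableSpace Ω] {P : Measure Ω}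
    {U V : Ω → ℝ} (hU : Measurable U) (hV : Measurable V) {v v' : NNReal}
    (hUv : P.map U = gaussianReal 0 v) (hUV : P.map (fun ω => U ω + V ω) = gaussianReal 0 v')
    (hv : v' < 4 * v) :
    Tendsto (fun u : ℝ => P[|{ω | u < U ω}] {ω | u < V ω}) atTop (nhds 0) := by
  have hv0 : v ≠ 0 := by rintro rfl; simp at hv
  obtain ⟨w, hw', hw⟩ := exists_between hv
  have hw0 : (0 : ℝ) < w := (zero_le (a := v')).trans_lt hw'
  have hwv : (w : ℝ) < 4 * v := by exact_mod_cast hw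
  have hvpos : (0 : ℝ) < v := by positivity
  have hc : 0 < √(2 * Real.pi * v) := by positivity
  have hbound : ∀ᶠ u : ℝ in atTop, P[|{ω | u < U ω}] {ω | u < V ω} ≤
      ENNReal.ofReal (√(2 * Real.pi * v) *
        Real.exp ((u + 1) ^ 2 / (2 * v) - (2 * u) ^ 2 / (2 * w))) := by
    filter_upwards [eventually_ge_atTop 0] with u hu
    rw [cond_apply (measurableSet_lt measurable_const hU)]
    have h1 := le_gaussianReal_Ioi hv0 hu
    rw [← hUv, Measure.map_apply hU measurableSet_Ioi] at h1
    have h2 := gaussianReal_Ici_le hw'.le (u := 2 * u) (by positivity)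
    rw [← hUV, Measure.map_apply (hU.fun_add hV) measurableSet_Ici] at h2
    have h3 : P ({ω | u < U ω} ∩ {ω | u < V ω}) ≤
        P ((fun ω => U ω + V ω) ⁻¹' Set.Ici (2 * u)) := by
      refine measure_mono fun ω hω => ?_
      simp only [Set.mem_inter_iff, Set.mem_ofPred_eq, Set.mem_preimage, Set.mem_Ici] at hω ⊢
      linarith
    refine (mul_le_mul' (ENNReal.inv_le_inv.2 h1) (h3.trans h2)).trans ?_
    rw [← ENNReal.ofReal_inv_of_pos (by positivity), ← ENNReal.ofReal_mul (by positivity)]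
    apply ENNReal.ofReal_le_ofReal
    rw [mul_inv, inv_inv, ← Real.exp_neg, mul_assoc, ← Real.exp_add]
    apply le_of_eq
    congr 2
    ring
  have hexp : Tendsto (fun u : ℝ => (u + 1) ^ 2 / (2 * v) - (2 * u) ^ 2 / (2 * w))
      atTop atBot := by
    have ha : (1 / (2 * v) - 2 / w : ℝ) < 0 := by
      rw [sub_neg, div_lt_div_iff₀ (by positivity) hw0]
      linarith
    have : Tendsto (fun u : ℝ => u * ((1 / (2 * v) - 2 / w : ℝ) * u + 1 / v) + 1 / (2 * v))
        atTop atBot := by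
      refine tendsto_atBot_add_const_right _ _ (tendsto_id.atTop_mul_atBot₀ ?_)
      exact tendsto_atBot_add_const_right _ _ (tendsto_id.const_mul_atTop_of_neg ha)
    refine this.congr fun u => ?_
    field_simp
    ring
  have hlim := ENNReal.tendsto_ofReal
    ((Real.tendsto_exp_atBot.comp hexp).const_mul √(2 * Real.pi * v))
  rw [mul_zero, ENNReal.ofReal_zero] at hlim
  exact tendsto_of_tendsto_of_tendsto_of_le_of_le' tendsto_const_nhds hlim
    (Eventually.of_forall fun _ => zero_le) hbound

lemma integrable_cos_mul (μ : Measure ℝ) [IsFiniteMeasure μ] (t : ℝ) :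
    Integrable (fun x => Real.cos (t * x)) μ :=
  Integrable.of_bound (by fun_prop) 1 (ae_of_all _ fun x => Real.abs_cos_le_one _)

lemma eq_integral_cos_of_ofReal_eq_integral_exp {μ : Measure ℝ} [IsFiniteMeasure μ] {t r : ℝ}
    (h : (r : ℂ) = ∫ x : ℝ, Complex.exp (Complex.I * t * x) ∂μ) :
    r = ∫ x, Real.cos (t * x) ∂μ := by
  have hexp : ∀ x : ℝ, Complex.exp (Complex.I * t * x) = Complex.exp ((t * x : ℝ) * Complex.I) := by
    intro x
    push_cast
    ring_nf
  simp_rw [hexp] at h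
  have hint : Integrable (fun x : ℝ => Complex.exp ((t * x : ℝ) * Complex.I)) μ :=
    Integrable.of_bound (by fun_prop) 1
      (ae_of_all _ fun x => (Complex.norm_exp_ofReal_mul_I _).le)
  have h2 := congrArg Complex.re h
  rw [Complex.ofReal_re, ← RCLike.re_eq_complex_re, ← integral_re hint] at h2
  simpa only [RCLike.re_eq_complex_re, Complex.exp_ofReal_mul_I_re] using h2

/-- The Fourier transform of a measure not concentrated at `0` drops below its value at `0`
arbitrarily close to `0`. -/
lemma exists_integral_cos_lt {μ : Measure ℝ} [IsFiniteMeasure μ] (hμ : 0 < μ ({(0 : ℝ)}ᶜ))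
    {η : ℝ} (hη : 0 < η) :
    ∃ s, 0 < s ∧ s ≤ η ∧ ∫ x, Real.cos (s * x) ∂μ < ∫ x, Real.cos (0 * x) ∂μ := by
  by_contra! h
  have hcos : ∀ n : ℕ, ∀ᵐ x ∂μ, Real.cos (η / (n + 1) * x) = 1 := by
    intro n
    have hle := h (η / (n + 1)) (by positivity) (div_le_self hη.le (by simp))
    have hint := (integrable_cos_mul μ 0).sub (integrable_cos_mul μ (η / (n + 1)))
    have hnonneg : 0 ≤ fun x => Real.cos (0 * x) - Real.cos (η / (n + 1) * x) := fun x => by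
      simpa using Real.cos_le_one _
    have h0 : ∫ x, (Real.cos (0 * x) - Real.cos (η / (n + 1) * x)) ∂μ = 0 := by
      refine le_antisymm ?_ (integral_nonneg hnonneg)
      rw [integral_sub (integrable_cos_mul μ 0) (integrable_cos_mul μ _)]
      linarith
    filter_upwards [(integral_eq_zero_iff_of_nonneg hnonneg hint).1 h0] with x hx
    simp only [zero_mul, Real.cos_zero, Pi.zero_apply] at hx
    linarith
  have hzero : ∀ᵐ x ∂μ, x = 0 := by
    filter_upwards [ae_all_iff.2 hcos] with x hx
    obtain ⟨n, hn⟩ := exists_nat_gt (η * |x|)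
    have hn' : |η / (n + 1) * x| < 2 * Real.pi := by
      rw [abs_mul, abs_of_pos (by positivity), div_mul_eq_mul_div]
      have : η * |x| / (n + 1) < 1 := (div_lt_one (by positivity)).2 (by linarith)
      linarith [Real.two_le_pi]
    rw [abs_lt] at hn'
    have := (Real.cos_eq_one_iff_of_lt_of_lt hn'.1 hn'.2).1 (hx n)
    have hne : η / (n + 1) ≠ 0 := by positivity
    exact (mul_eq_zero.1 this).resolve_left hne
  exact hμ.ne' hzero

lemma memLp_two_of_map_eq_gaussianReal {Ω : Type*} [MeasurableSpace Ω] {P : Measure Ω}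
    {Y : Ω → ℝ} (hY : Measurable Y) {v : NNReal} (h : P.map Y = gaussianReal 0 v) :
    MemLp Y 2 P := by
  have := memLp_id_gaussianReal' (μ := 0) (v := v) 2 (by simp)
  rw [← h] at this
  exact (memLp_map_measure_iff aestronglyMeasurable_id hY.aemeasurable).1 this

lemma integral_mul_self_of_map_eq_gaussianReal {Ω : Type*} [MeasurableSpace Ω] {P : Measure Ω}
    {Y : Ω → ℝ} (hY : Measurable Y) {v : NNReal} (h : P.map Y = gaussianReal 0 v) :
    ∫ ω, Y ω * Y ω ∂P = v := by
  rw [← integral_map (f := fun x : ℝ => x * x) hY.aemeasurable (by fun_prop), h,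
    ← variance_id_gaussianReal (μ := 0) (v := v),
    variance_of_integral_eq_zero aemeasurable_id (by simp [integral_id_gaussianReal])]
  simp [sq]

lemma IsZeroMeanGaussianProcess.exists_map_eq {Ω : Type*} [MeasurableSpace Ω] {P : Measure Ω}
    {X : ℝ → Ω → ℝ} (hX : IsZeroMeanGaussianProcess P X) (t : ℝ) :
    ∃ v : NNReal, P.map (X t) = gaussianReal 0 v := by
  simpa using hX.2 1 (fun _ => t) (fun _ => 1)

lemma IsZeroMeanGaussianProcess.exists_map_add_eq {Ω : Type*} [MeasurableSpace Ω]
    {P : Measure Ω} {X : ℝ → Ω → ℝ} (hX : IsZeroMeanGaussianProcess P X) (s t : ℝ) :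
    ∃ v : NNReal, P.map (fun ω => X s ω + X t ω) = gaussianReal 0 v := by
  simpa [Fin.sum_univ_two] using hX.2 2 ![s, t] (fun _ => 1)

lemma IsZeroMeanGaussianProcess.tendsto_cond_gt {Ω : Type*} [MeasurableSpace Ω]
    {P : Measure Ω} {X : ℝ → Ω → ℝ} (hX : IsZeroMeanGaussianProcess P X) {R : ℝ → ℝ}
    (hcov : ∀ s t : ℝ, ∫ ω, X s ω * X t ω ∂P = R (s - t)) {s : ℝ} (hs : R s < R 0) :
    Tendsto (fun u : ℝ => P[|{ω | u < X 0 ω}] {ω | u < X s ω}) atTop (nhds 0) := by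
  obtain ⟨v, hv⟩ := hX.exists_map_eq 0
  obtain ⟨v₁, hv₁⟩ := hX.exists_map_eq s
  obtain ⟨v', hv'⟩ := hX.exists_map_add_eq 0 s
  have h0 := memLp_two_of_map_eq_gaussianReal (hX.1 0) hv
  have h1 := memLp_two_of_map_eq_gaussianReal (hX.1 s) hv₁
  refine tendsto_cond_gt_of_gaussianReal (hX.1 0) (hX.1 s) hv hv' ?_
  have e0 := integral_mul_self_of_map_eq_gaussianReal (hX.1 0) hv
  rw [hcov, sub_zero] at e0
  have e1 := integral_mul_self_of_map_eq_gaussianReal ((hX.1 0).fun_add (hX.1 s)) hv'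
  have e2 : ∫ ω, (X 0 ω + X s ω) * (X 0 ω + X s ω) ∂P = R 0 + R s + (R s + R 0) := by
    have i00 : Integrable (fun ω => X 0 ω * X 0 ω) P := h0.integrable_mul h0
    have is0 : Integrable (fun ω => X s ω * X 0 ω) P := h1.integrable_mul h0
    have iss : Integrable (fun ω => X s ω * X s ω) P := h1.integrable_mul h1
    calc _ = ∫ ω, ((X 0 ω * X 0 ω + X s ω * X 0 ω) + (X s ω * X 0 ω + X s ω * X s ω)) ∂P := by
          congr with ω
          ring
      _ = _ := by
          rw [integral_add (i00.fun_add is0) (is0.fun_add iss), integral_add i00 is0,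
            integral_add is0 iss, hcov, hcov, hcov]
          simp
  rw [← NNReal.coe_lt_coe, ← e1]
  push_cast
  linarith

/-- conditionally on `[X₀ > u]`, the excursion endpoints
`τ_u⁺ = inf {t ≥ 0 : X_t ≤ u}` and `τ_u⁻ = sup {t ≤ 0 : X_t ≤ u}` tend to `0`
in probability as `u → ∞`. -/
theorem excursion_stmt2
    (μ : Measure ℝ) [IsFiniteMeasure μ]
    (hμ_nonnull : μ Set.univ ≠ 0)
    (hμ_symm : μ.map (fun x => -x) = μ)
    (hμ_mom2 : Integrable (fun x : ℝ => x ^ 2) μ)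
    (hμ_nondeg : 0 < μ ({(0 : ℝ)}ᶜ))
    (R : ℝ → ℝ)
    (hR : ∀ t : ℝ, (R t : ℂ) = ∫ x : ℝ, Complex.exp (Complex.I * t * x) ∂μ)
    {Ω : Type*} [MeasurableSpace Ω] (P : Measure Ω) [IsProbabilityMeasure P]
    (X : ℝ → Ω → ℝ)
    (hX_gauss : IsZeroMeanGaussianProcess P X)
    (hX_cont : ∀ ω, Continuous fun t => X t ω)
    (hX_cov : ∀ s t : ℝ, ∫ ω, X s ω * X t ω ∂P = R (s - t)) :
    ∀ η > (0 : ℝ),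
      Tendsto (fun u : ℝ =>
          P[|{ω | u < X 0 ω}] {ω | η < sInf {t : ℝ | 0 ≤ t ∧ X t ω ≤ u}})
        atTop (nhds 0) ∧
      Tendsto (fun u : ℝ =>
          P[|{ω | u < X 0 ω}] {ω | sSup {t : ℝ | t ≤ 0 ∧ X t ω ≤ u} < -η})
        atTop (nhds 0) := by
  intro η hη
  obtain ⟨s, hs0, hsη, hs⟩ := exists_integral_cos_lt hμ_nondeg hη
  rw [← eq_integral_cos_of_ofReal_eq_integral_exp (hR s),
    ← eq_integral_cos_of_ofReal_eq_integral_exp (hR 0)] at hs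
  have hsymm : R (-s) = R s := by
    have h1 := hX_cov s 0
    have h2 := hX_cov 0 s
    simp only [mul_comm (X 0 _), zero_sub, sub_zero] at h1 h2
    exact h2.symm.trans h1
  have hplus := hX_gauss.tendsto_cond_gt hX_cov hs
  have hminus := hX_gauss.tendsto_cond_gt hX_cov (hsymm.trans_lt hs)
  constructor
  · refine tendsto_of_tendsto_of_tendsto_of_le_of_le tendsto_const_nhds hplus
      (fun _ => zero_le) fun u => measure_mono fun ω hω => ?_
    simp only [Set.mem_ofPred_eq] at hω ⊢
    by_contra! hle
    have : sInf {t : ℝ | 0 ≤ t ∧ X t ω ≤ u} ≤ s := csInf_le ⟨0, fun t ht => ht.1⟩ ⟨hs0.le, hle⟩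
    linarith
  · refine tendsto_of_tendsto_of_tendsto_of_le_of_le tendsto_const_nhds hminus
      (fun _ => zero_le) fun u => measure_mono fun ω hω => ?_
    simp only [Set.mem_ofPred_eq] at hω ⊢
    by_contra! hle
    have : -s ≤ sSup {t : ℝ | t ≤ 0 ∧ X t ω ≤ u} :=
      le_csSup ⟨0, fun t ht => ht.1⟩ ⟨by linarith, hle⟩
    linarith
end

section
/- Let μ be a finite non-null symmetric measure on ℝ with μ([x,∞)) > 0 for all x > 0 and μ([x,∞)) regularly varying at infinity with index −α, 0 < α < 2, and let R(t) = ∫ e^{itx} μ(dx), h(y) = inf{x ≥ 0 : μ([x,∞)) ≤ y}, δ_u = (h(u^{−2}))^{−1}. Then for each fixed t ≠ 0, √(R(0) − R(tδ_u)) ~ C_α^{1/2} |t|^{α/2} u^{−1} as u → ∞, where C_α = π/(Γ(α) sin(πα/2)). -/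
open MeasureTheory ProbabilityTheory Filter

open Real Set Topology in
lemma integrableOn_and_integral_rpow_div_one_add_sq {α : ℝ} (hα0 : 0 < α) (hα2 : α < 2) :
    IntegrableOn (fun s : ℝ => s ^ (α - 1) / (1 + s ^ 2)) (Ioi 0) ∧
      ∫ s in Ioi (0 : ℝ), s ^ (α - 1) / (1 + s ^ 2) = π / (2 * sin (π * α / 2)) := by
  set ν : Measure ℝ := volume.restrict (Ioi 0) with hν
  set f : ℝ × ℝ → ℝ := fun p => p.1 ^ (α - 1) * exp (-(p.2 * (1 + p.1 ^ 2))) with hf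
  have hmeas : Measurable f := by
    apply Measurable.mul
    · exact measurable_fst.pow_const _
    · fun_prop
  have hfw : ∀ s w : ℝ, f (s, w) = s ^ (α - 1) * exp (-w * s ^ (2 : ℝ)) * exp (-w) := by
    intro s w
    simp only [hf, rpow_two]
    rw [mul_assoc, ← Real.exp_add]
    ring_nf
  have hfint_s : ∀ w ∈ Ioi (0 : ℝ), Integrable (fun s => f (s, w)) ν := by
    intro w hw
    simp_rw [hfw]
    exact (integrableOn_rpow_mul_exp_neg_mul_rpow (by linarith) two_pos hw).mul_const _
  have hval_s : ∀ w ∈ Ioi (0 : ℝ), ∫ s, f (s, w) ∂ν =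
      1 / 2 * Gamma (α / 2) * (exp (-w) * w ^ ((1 - α / 2) - 1)) := by
    intro w hw
    simp_rw [hfw]
    rw [integral_mul_const, hν, integral_rpow_mul_exp_neg_mul_rpow two_pos (by linarith) hw,
      show -(α - 1 + 1) / 2 = (1 - α / 2) - 1 by ring, show (α - 1 + 1) / 2 = α / 2 by ring]
    ring
  have hgam := (Real.GammaIntegral_convergent (s := 1 - α / 2) (by linarith))
  have hprod : Integrable f (ν.prod ν) := by
    rw [integrable_prod_iff' hmeas.aestronglyMeasurable]
    refine ⟨(ae_restrict_iff' measurableSet_Ioi).2 (ae_of_all _ hfint_s), ?_⟩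
    refine IntegrableOn.congr_fun (hgam.const_mul (1 / 2 * Gamma (α / 2))) (fun w hw => ?_) measurableSet_Ioi
    rw [← hval_s w hw]
    refine setIntegral_congr_fun measurableSet_Ioi (fun s hs => ?_)
    rw [norm_of_nonneg]
    exact mul_nonneg (rpow_nonneg (le_of_lt hs) _) (exp_nonneg _)
  have hval_w : ∀ s ∈ Ioi (0 : ℝ), ∫ w, f (s, w) ∂ν = s ^ (α - 1) / (1 + s ^ 2) := by
    intro s hs
    have h1 := integral_exp_mul_Ioi (a := -(1 + s ^ 2)) (by nlinarith [sq_nonneg s]) 0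
    simp only [hf]
    rw [integral_const_mul, div_eq_mul_inv]
    congr 1
    rw [hν]
    calc _ = ∫ x in Ioi (0 : ℝ), exp (-(1 + s ^ 2) * x) := by
          refine integral_congr_ae (ae_of_all _ fun x => ?_)
          simp only []
          ring_nf
      _ = _ := by rw [h1]; field_simp; simp
  constructor
  · refine IntegrableOn.congr_fun hprod.integral_prod_left hval_w measurableSet_Ioi
  · rw [← setIntegral_congr_fun measurableSet_Ioi hval_w]
    have := integral_integral_swap (f := fun s w => f (s, w)) hprod
    rw [← hν, this, hν, setIntegral_congr_fun measurableSet_Ioi hval_s, integral_const_mul,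
      ← Gamma_eq_integral (by linarith), mul_assoc, Gamma_mul_Gamma_one_sub,
      show π * (α / 2) = π * α / 2 by ring]
    field_simp

open Real Set Topology in
lemma integral_sin_mul_exp_neg (s : ℝ) (N : ℕ) :
    ∫ y in (0 : ℝ)..(N * (2 * π)), sin y * exp (-(y * s)) =
      (1 - exp (-(N * (2 * π) * s))) / (1 + s ^ 2) := by
  have hs : 1 + s ^ 2 ≠ 0 := by positivity
  have hd : ∀ y ∈ uIcc (0 : ℝ) (N * (2 * π)),
      HasDerivAt (fun y => -(exp (-(y * s)) * (cos y + s * sin y)) / (1 + s ^ 2))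
        (sin y * exp (-(y * s))) y := by
    intro y _
    have h1 : HasDerivAt (fun y : ℝ => exp (-(y * s))) (exp (-(y * s)) * -(1 * s)) y :=
      (((hasDerivAt_id y).mul_const s).neg).exp
    have h2 : HasDerivAt (fun y : ℝ => cos y + s * sin y) (-sin y + s * cos y) y :=
      (hasDerivAt_cos y).add ((hasDerivAt_sin y).const_mul s)
    refine ((h1.mul h2).neg.div_const (1 + s ^ 2)).congr_deriv ?_
    field_simp
    ring
  rw [intervalIntegral.integral_eq_sub_of_hasDerivAt hd
    (Continuous.intervalIntegrable (by fun_prop) _ _)]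
  have h3 : cos (N * (2 * π)) = 1 := Real.cos_nat_mul_two_pi N
  have h4 : sin (N * (2 * π)) = 0 := by
    have := Real.sin_nat_mul_pi (2 * N)
    rw [← this]; push_cast; ring_nf
  rw [h3, h4]
  simp
  field_simp
  ring

open Real Set Topology in
lemma intervalIntegrable_sin_mul_rpow_neg {α : ℝ} (hα2 : α < 2) {a : ℝ} (ha : 0 ≤ a) :
    IntervalIntegrable (fun y => sin y * y ^ (-α)) volume 0 a := by
  refine (intervalIntegral.intervalIntegrable_rpow' (r := 1 - α) (by linarith)).mono_fun'
    (Measurable.aestronglyMeasurable (by fun_prop)) ?_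
  rw [uIoc_of_le ha]
  refine (ae_restrict_iff' measurableSet_Ioc).2 (ae_of_all _ fun y hy => ?_)
  have hy0 : 0 < y := hy.1
  beta_reduce
  rw [norm_mul, norm_of_nonneg (rpow_nonneg hy0.le _), sub_eq_add_neg, rpow_add hy0, rpow_one]
  gcongr
  simpa [abs_of_pos hy0] using abs_sin_le_abs (x := y)

open Real Set Topology in
lemma tendsto_integral_sin_mul_rpow_neg {α : ℝ} (hα0 : 0 < α) (hα2 : α < 2) :
    Tendsto (fun N : ℕ => ∫ y in (0 : ℝ)..(N * (2 * π)), sin y * y ^ (-α)) atTop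
      (𝓝 (π / (2 * (Gamma α * sin (π * α / 2))))) := by
  obtain ⟨hI, hval⟩ := integrableOn_and_integral_rpow_div_one_add_sq hα0 hα2
  have hΓ := Gamma_pos_of_pos hα0
  have key : ∀ N : ℕ, ∫ y in (0 : ℝ)..(N * (2 * π)), sin y * y ^ (-α) =
      (Gamma α)⁻¹ * ∫ s in Ioi (0 : ℝ),
        s ^ (α - 1) / (1 + s ^ 2) * (1 - exp (-(N * (2 * π) * s))) := by
    intro N
    set M : ℝ := N * (2 * π) with hM
    have hM0 : 0 ≤ M := by positivity
    set f : ℝ × ℝ → ℝ := fun p => sin p.1 * (p.2 ^ (α - 1) * exp (-(p.1 * p.2))) with hf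
    have hmeas : Measurable f := by
      apply Measurable.mul (by fun_prop)
      apply Measurable.mul
      · exact measurable_snd.pow_const _
      · fun_prop
    have hIs : ∀ y ∈ Ioc (0 : ℝ) M,
        IntegrableOn (fun s : ℝ => s ^ (α - 1) * exp (-(y * s))) (Ioi 0) := by
      intro y hy
      have := integrableOn_rpow_mul_exp_neg_mul_rpow (s := α - 1) (p := 1) (by linarith) one_pos hy.1
      simpa using this
    have hVs : ∀ y ∈ Ioc (0 : ℝ) M,
        ∫ s in Ioi (0 : ℝ), s ^ (α - 1) * exp (-(y * s)) = y ^ (-α) * Gamma α := by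
      intro y hy
      rw [integral_rpow_mul_exp_neg_mul_Ioi hα0 hy.1, one_div, inv_rpow hy.1.le, rpow_neg hy.1.le]
    have hsinI := (intervalIntegrable_iff_integrableOn_Ioc_of_le hM0).1
      (intervalIntegrable_sin_mul_rpow_neg hα2 hM0)
    have hprod : Integrable f ((volume.restrict (Ioc 0 M)).prod (volume.restrict (Ioi 0))) := by
      rw [integrable_prod_iff hmeas.aestronglyMeasurable]
      refine ⟨(ae_restrict_iff' measurableSet_Ioc).2
        (ae_of_all _ fun y hy => (hIs y hy).const_mul (sin y)), ?_⟩
      refine IntegrableOn.congr_fun (hsinI.norm.mul_const (Gamma α)) (fun y hy => ?_) measurableSet_Ioc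
      simp only [hf, norm_mul]
      rw [integral_const_mul, mul_assoc, norm_of_nonneg (rpow_nonneg hy.1.le _), ← hVs y hy]
      congr 1
      refine setIntegral_congr_fun measurableSet_Ioi (fun s hs => ?_)
      rw [norm_of_nonneg (rpow_nonneg (le_of_lt hs) _), norm_of_nonneg (exp_nonneg _)]
    have hsw := integral_integral_swap (f := fun y s => f (y, s)) hprod
    rw [eq_inv_mul_iff_mul_eq₀ hΓ.ne', intervalIntegral.integral_of_le hM0]
    calc _ = ∫ y in Ioc 0 M, ∫ s in Ioi (0 : ℝ), f (y, s) := by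
          rw [← integral_const_mul]
          refine setIntegral_congr_fun measurableSet_Ioc (fun y hy => ?_)
          simp only [hf]
          rw [integral_const_mul, hVs y hy]
          ring
      _ = _ := hsw
      _ = _ := by
          refine setIntegral_congr_fun measurableSet_Ioi (fun s hs => ?_)
          have := integral_sin_mul_exp_neg s N
          rw [← hM, intervalIntegral.integral_of_le hM0] at this
          simp only [hf]
          rw [div_mul_eq_mul_div, mul_div_assoc, ← this, ← integral_const_mul]
          congr 1
          ext y
          ring
  simp_rw [key]
  have hlim : Tendsto (fun N : ℕ => ∫ s in Ioi (0 : ℝ),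
        s ^ (α - 1) / (1 + s ^ 2) * (1 - exp (-(N * (2 * π) * s)))) atTop
      (𝓝 (∫ s in Ioi (0 : ℝ), s ^ (α - 1) / (1 + s ^ 2))) := by
    refine tendsto_integral_of_dominated_convergence
      (fun s => s ^ (α - 1) / (1 + s ^ 2)) (fun N => ?_) hI ?_ ?_
    · exact hI.aestronglyMeasurable.mul (Continuous.aestronglyMeasurable (by fun_prop))
    · intro N
      refine (ae_restrict_iff' measurableSet_Ioi).2 (ae_of_all _ fun s hs => ?_)
      have hs : 0 < s := hs
      have h1 : exp (-(N * (2 * π) * s)) ≤ 1 := exp_le_one_iff.2 (by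
        rw [neg_nonpos]; positivity)
      have h2 := exp_pos (-(N * (2 * π) * s))
      have h3 : 0 ≤ s ^ (α - 1) / (1 + s ^ 2) := by positivity
      rw [norm_of_nonneg (mul_nonneg h3 (by linarith))]
      exact mul_le_of_le_one_right h3 (by linarith)
    · refine (ae_restrict_iff' measurableSet_Ioi).2 (ae_of_all _ fun s hs => ?_)
      have hs : 0 < s := hs
      have h1 : Tendsto (fun N : ℕ => (N : ℝ) * (2 * π) * s) atTop atTop :=
        (tendsto_natCast_atTop_atTop.atTop_mul_const (by positivity)).atTop_mul_const hs
      have h2 := (tendsto_exp_neg_atTop_nhds_zero.comp h1)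
      have := (h2.const_sub 1).const_mul (s ^ (α - 1) / (1 + s ^ 2))
      simpa using this
  rw [hval] at hlim
  convert hlim.const_mul (Gamma α)⁻¹ using 2
  field_simp

open Real Set Topology in
lemma exists_rpow_mul_le_of_tendsto_doubling {G : ℝ → ℝ} (hG : Antitone G)
    (hpos : ∀ x > 0, 0 < G x) {α β : ℝ} (hβ : 0 < β) (hαβ : α < β)
    (h2 : Tendsto (fun x => G (2 * x) / G x) atTop (𝓝 (2 ^ (-α)))) :
    ∃ C > 0, ∃ X > 0, ∀ b ≥ X, ∀ x, 0 < x → x ≤ b → x ^ β * G x ≤ C * (b ^ β * G b) := by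
  have hlt : (2 : ℝ) ^ (-β) < 2 ^ (-α) := rpow_lt_rpow_of_exponent_lt (by norm_num) (by linarith)
  obtain ⟨X, hX⟩ := (((h2.eventually_const_lt hlt).and (eventually_gt_atTop 0))).exists_forall_of_atTop
  have hX0 : 0 < X := (hX X le_rfl).2
  have hmono : ∀ x ≥ X, x ^ β * G x ≤ (2 * x) ^ β * G (2 * x) := by
    intro x hx
    have hx0 : 0 < x := hX0.trans_le hx
    have h := (hX x hx).1
    rw [lt_div_iff₀ (hpos x hx0), rpow_neg two_pos.le] at h
    rw [mul_rpow two_pos.le hx0.le]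
    have h2β : (0 : ℝ) < 2 ^ β := by positivity
    have : G x ≤ 2 ^ β * G (2 * x) := by
      rw [inv_mul_lt_iff₀ h2β] at h
      exact h.le
    calc x ^ β * G x ≤ x ^ β * (2 ^ β * G (2 * x)) := by gcongr
      _ = _ := by ring
  have hind : ∀ n : ℕ, ∀ x ≥ X, ∀ b, x ≤ b → b ≤ 2 ^ n * x →
      x ^ β * G x ≤ 2 ^ β * (b ^ β * G b) := by
    intro n
    induction n with
    | zero =>
      intro x hx b hxb hbx
      have hx0 : 0 < x := hX0.trans_le hx
      obtain rfl : b = x := le_antisymm (by simpa using hbx) hxb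
      have : 0 < G b := hpos b hx0
      exact le_mul_of_one_le_left (by positivity) (one_le_rpow (by norm_num) hβ.le)
    | succ n ih =>
      intro x hx b hxb hbx
      have hx0 : 0 < x := hX0.trans_le hx
      have hGb : 0 < G b := hpos b (hx0.trans_le hxb)
      refine (hmono x hx).trans ?_
      rcases le_total b (2 * x) with hb | hb
      · rw [mul_rpow two_pos.le hx0.le, mul_assoc]
        have hGx : 0 < G (2 * x) := hpos _ (by positivity)
        have hb0 : 0 < b := hx0.trans_le hxb
        have := hG hb
        gcongr
      · exact ih (2 * x) (by linarith) b hb (by rw [pow_succ] at hbx; linarith)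
  have hGX := hpos X hX0
  have hlarge : ∀ x ≥ X, ∀ b, x ≤ b → x ^ β * G x ≤ 2 ^ β * (b ^ β * G b) := by
    intro x hx b hxb
    have hx0 : 0 < x := hX0.trans_le hx
    obtain ⟨n, hn⟩ := pow_unbounded_of_one_lt (b / x) (one_lt_two (α := ℝ))
    exact hind n x hx b hxb ((div_le_iff₀ hx0).1 hn.le)
  have hG0 : G X ≤ G 0 := hG hX0.le
  have hr : 1 ≤ G 0 / G X := (one_le_div hGX).2 hG0
  refine ⟨G 0 / G X * 2 ^ β, by positivity, X, hX0, fun b hb x hx0 hxb => ?_⟩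
  have hGb : 0 < G b := hpos b (hx0.trans_le hxb)
  have hb0 : 0 < b := hx0.trans_le hxb
  rcases le_total X x with hx | hx
  · refine (hlarge x hx b hxb).trans ?_
    rw [mul_assoc]
    exact le_mul_of_one_le_left (by positivity) hr
  · calc x ^ β * G x ≤ X ^ β * G 0 := by
          gcongr
          · exact (hpos x hx0).le
          · exact hG hx0.le
      _ = G 0 / G X * (X ^ β * G X) := by field_simp
      _ ≤ G 0 / G X * (2 ^ β * (b ^ β * G b)) := by
          exact mul_le_mul_of_nonneg_left (hlarge X le_rfl b hb) (by positivity)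
      _ = _ := by ring

open Real Set Topology in
lemma integral_one_sub_cos_truncated (μ : Measure ℝ) [IsFiniteMeasure μ] {b M : ℝ} (hb : 0 < b)
    (hM : 0 ≤ M) :
    ∫ x, (1 - cos (max 0 (min M (x / b)))) ∂μ =
      ∫ y in (0 : ℝ)..M, sin y * μ.real (Ici (b * y)) := by
  set f : ℝ → ℝ → ℝ := fun x y => {p : ℝ × ℝ | b * p.2 ≤ p.1}.indicator (fun p => sin p.2) (x, y)
    with hf
  have hS : MeasurableSet {p : ℝ × ℝ | b * p.2 ≤ p.1} :=
    measurableSet_le (by fun_prop) (by fun_prop)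
  have hfint : Integrable (Function.uncurry f) (μ.prod (volume.restrict (Ioc 0 M))) := by
    have h1 : Integrable (fun p : ℝ × ℝ => sin p.2) (μ.prod (volume.restrict (Ioc 0 M))) :=
      Integrable.of_bound (Measurable.aestronglyMeasurable (by fun_prop)) 1
        (ae_of_all _ fun p => abs_sin_le_one _)
    exact h1.indicator hS
  have hsw := integral_integral_swap hfint
  rw [intervalIntegral.integral_of_le hM]
  calc _ = ∫ x, (∫ y in Ioc 0 M, f x y) ∂μ := by
        refine integral_congr_ae (ae_of_all _ fun x => ?_)
        have h1 : ∀ y, f x y = (Iic (x / b)).indicator sin y := by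
          intro y
          simp only [hf, indicator, mem_ofPred_eq, mem_Iic, le_div_iff₀ hb, mul_comm b]
        simp_rw [h1]
        rw [setIntegral_indicator measurableSet_Iic, Ioc_inter_Iic]
        rcases le_total 0 (min M (x / b)) with h | h
        · change _ = ∫ y in Ioc 0 (min M (x / b)), sin y
          rw [← intervalIntegral.integral_of_le h, integral_sin, max_eq_right h, cos_zero]
        · change _ = ∫ y in Ioc 0 (min M (x / b)), sin y
          rw [Ioc_eq_empty h.not_gt, max_eq_left h]
          simp
    _ = _ := hsw
    _ = _ := by
        refine setIntegral_congr_fun measurableSet_Ioc (fun y _ => ?_)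
        have h1 : ∀ x, f x y = (Ici (b * y)).indicator (fun _ => sin y) x := by
          intro x
          simp only [hf, indicator, mem_ofPred_eq, mem_Ici]
        simp_rw [h1]
        rw [integral_indicator_const _ measurableSet_Ici, smul_eq_mul, mul_comm]

open Real Set Topology in
lemma abs_integral_one_sub_cos_sub_truncated_le (μ : Measure ℝ) [IsFiniteMeasure μ] {b : ℝ}
    (hb : 0 < b) (N : ℕ) :
    |∫ x, (1 - cos (max 0 (x / b))) ∂μ -
        ∫ x, (1 - cos (max 0 (min (N * (2 * π)) (x / b)))) ∂μ| ≤
      2 * μ.real (Ici (N * (2 * π) * b)) := by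
  have hI : ∀ g : ℝ → ℝ, Continuous g → Integrable (fun x => 1 - cos (g x)) μ := fun g hg =>
    Integrable.of_bound (Continuous.aestronglyMeasurable (by fun_prop)) 2
      (ae_of_all _ fun x => by
        rw [norm_of_nonneg (by linarith [cos_le_one (g x)])]; linarith [neg_one_le_cos (g x)])
  rw [← integral_sub (hI _ (by fun_prop)) (hI _ (by fun_prop)), ← norm_eq_abs]
  calc _ ≤ ∫ x, (Ici (N * (2 * π) * b)).indicator (fun _ => (2 : ℝ)) x ∂μ := by
        refine norm_integral_le_of_norm_le
          ((integrable_const (2 : ℝ)).indicator measurableSet_Ici) (ae_of_all _ fun x => ?_)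
        by_cases hx : N * (2 * π) ≤ x / b
        · have h0 : 0 ≤ x / b := le_trans (by positivity) hx
          rw [indicator_of_mem (by rwa [mem_Ici, ← le_div_iff₀ hb]), min_eq_left hx,
            max_eq_right h0, max_eq_right (by positivity), cos_nat_mul_two_pi, sub_self, sub_zero,
            norm_of_nonneg (by linarith [cos_le_one (x / b)])]
          linarith [neg_one_le_cos (x / b)]
        · rw [indicator_of_notMem (by rwa [mem_Ici, ← le_div_iff₀ hb]),
            min_eq_right (not_le.1 hx).le, sub_self, norm_zero]
    _ = _ := by
        rw [integral_indicator_const _ measurableSet_Ici, smul_eq_mul, mul_comm]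

open Real Set Topology in
lemma tendsto_integral_one_sub_cos_div_tail {α : ℝ} (hα0 : 0 < α) (hα2 : α < 2)
    (μ : Measure ℝ) [IsFiniteMeasure μ] (hpos : ∀ x > (0 : ℝ), 0 < μ.real (Ici x))
    (hrv : ∀ c > (0 : ℝ),
      Tendsto (fun x : ℝ => μ.real (Ici (c * x)) / μ.real (Ici x)) atTop (𝓝 (c ^ (-α)))) :
    Tendsto (fun b : ℝ => (∫ x, (1 - cos (max 0 (x / b))) ∂μ) / μ.real (Ici b)) atTop
      (𝓝 (π / (2 * (Gamma α * sin (π * α / 2))))) := by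
  set G : ℝ → ℝ := fun x => μ.real (Ici x) with hGdef
  have hG : Antitone G := fun x y hxy => measureReal_mono (Ici_subset_Ici.2 hxy)
  set K := π / (2 * (Gamma α * sin (π * α / 2)))
  have hK := tendsto_integral_sin_mul_rpow_neg hα0 hα2
  obtain ⟨β, hαβ, hβ2⟩ := exists_between hα2
  have hβ0 : 0 < β := hα0.trans hαβ
  obtain ⟨C, hC, X, hX, hpot⟩ :=
    exists_rpow_mul_le_of_tendsto_doubling hG hpos hβ0 hαβ (hrv 2 two_pos)
  have htrunc : ∀ M : ℝ, 0 ≤ M → Tendsto (fun b : ℝ => ∫ y in (0 : ℝ)..M, sin y * (G (b * y) / G b))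
      atTop (𝓝 (∫ y in (0 : ℝ)..M, sin y * y ^ (-α))) := by
    intro M hM
    refine intervalIntegral.tendsto_integral_filter_of_dominated_convergence
      (fun y => C * y ^ (1 - β) + 1) ?_ ?_ ?_ ?_
    · refine Eventually.of_forall fun b => Measurable.aestronglyMeasurable ?_
      exact measurable_sin.mul ((hG.measurable.comp (measurable_const_mul b)).div_const _)
    · filter_upwards [eventually_ge_atTop X] with b hb
      refine ae_of_all _ fun y hy => ?_
      rw [uIoc_of_le hM] at hy
      have hy0 : 0 < y := hy.1
      have hb0 : 0 < b := hX.trans_le hb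
      have hGb : 0 < G b := hpos b hb0
      have hGy : 0 < G (b * y) := hpos _ (by positivity)
      rw [norm_mul, norm_of_nonneg (by positivity : 0 ≤ G (b * y) / G b), norm_eq_abs]
      have hnn : 0 ≤ C * y ^ (1 - β) := by positivity
      rcases le_total y 1 with h1 | h1
      · have h := hpot b hb (b * y) (by positivity) (by nlinarith)
        rw [mul_rpow hb0.le hy0.le] at h
        have h' : G (b * y) / G b ≤ C * y ^ (-β) := by
          rw [div_le_iff₀ hGb, rpow_neg hy0.le]
          have hbβ : 0 < b ^ β := by positivity
          have hyβ : 0 < y ^ β := by positivity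
          rw [mul_assoc, inv_mul_eq_div, ← mul_div_assoc, le_div_iff₀ hyβ]
          refine le_of_mul_le_mul_left ?_ hbβ
          linarith
        have hs : |sin y| ≤ y := by simpa [abs_of_pos hy0] using abs_sin_le_abs (x := y)
        calc |sin y| * (G (b * y) / G b) ≤ y * (C * y ^ (-β)) := by gcongr
          _ = C * y ^ (1 - β) := by rw [sub_eq_add_neg, rpow_add hy0, rpow_one]; ring
          _ ≤ _ := by linarith
      · have h' : G (b * y) / G b ≤ 1 := by
          rw [div_le_one hGb]; exact hG (by nlinarith)
        have := mul_le_one₀ (abs_sin_le_one y) (by positivity) h'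
        linarith
    · exact ((intervalIntegral.intervalIntegrable_rpow' (by linarith)).const_mul C).add
        intervalIntegrable_const
    · refine ae_of_all _ fun y hy => ?_
      rw [uIoc_of_le hM] at hy
      have := (hrv y hy.1).const_mul (sin y)
      simpa only [mul_comm y] using this
  have hAN : ∀ b > 0, ∀ N : ℕ, |(∫ x, (1 - cos (max 0 (x / b))) ∂μ) / G b -
      ∫ y in (0 : ℝ)..(N * (2 * π)), sin y * (G (b * y) / G b)| ≤
        2 * (G (N * (2 * π) * b) / G b) := by
    intro b hb N
    have h1 := abs_integral_one_sub_cos_sub_truncated_le μ hb N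
    have hGb : 0 < G b := hpos b hb
    rw [integral_one_sub_cos_truncated μ hb (by positivity)] at h1
    simp_rw [← mul_div_assoc]
    rw [intervalIntegral.integral_div, ← sub_div, abs_div, abs_of_pos hGb]
    gcongr
  have hMtop : Tendsto (fun N : ℕ => (N : ℝ) * (2 * π)) atTop atTop :=
    tendsto_natCast_atTop_atTop.atTop_mul_const (by positivity)
  have hMsmall : Tendsto (fun N : ℕ => 2 * ((N : ℝ) * (2 * π)) ^ (-α)) atTop (𝓝 0) := by
    simpa using ((tendsto_rpow_neg_atTop hα0).comp hMtop).const_mul 2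
  rw [Metric.tendsto_atTop']
  intro ε hε
  obtain ⟨N, ⟨hN1, hN2⟩, hN3⟩ := (((Metric.tendsto_nhds.1 hK (ε / 3) (by linarith)).and
    (hMsmall.eventually_lt_const (show 0 < ε / 3 by linarith))).and
      (hMtop.eventually_gt_atTop 0)).exists
  have hN4 := ((hrv _ hN3).const_mul 2).eventually_lt_const hN2
  have hN5 := Metric.tendsto_nhds.1 (htrunc _ hN3.le) (ε / 3) (by linarith)
  obtain ⟨B, hB⟩ := ((hN4.and hN5).and (eventually_gt_atTop 0)).exists_forall_of_atTop
  refine ⟨B, fun b hb => ?_⟩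
  obtain ⟨⟨h1, h2⟩, h3⟩ := hB b hb.le
  have h4 := hAN b h3 N
  rw [dist_eq] at *
  rw [abs_lt] at *
  rw [abs_le] at h4
  constructor <;> linarith [h4.1, h4.2, h2.1, h2.2, hN1.1, hN1.2]

open Real Set Topology in
lemma tendsto_sInf_le_atTop {G : ℝ → ℝ} (hG : Antitone G) (hpos : ∀ x > 0, 0 < G x)
    (h0 : Tendsto G atTop (𝓝 0)) :
    Tendsto (fun y => sInf {x : ℝ | 0 ≤ x ∧ G x ≤ y}) (𝓝[>] 0) atTop := by
  rw [tendsto_atTop]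
  intro X
  have hX : 0 < G (max X 1) := hpos _ (by positivity)
  filter_upwards [self_mem_nhdsWithin, mem_nhdsWithin_of_mem_nhds (Iio_mem_nhds hX)] with y hy hyX
  obtain ⟨x, hx⟩ := ((h0.eventually_le_const hy).and (eventually_ge_atTop 0)).exists
  refine le_csInf ⟨x, hx.2, hx.1⟩ fun z hz => ?_
  by_contra! h
  exact absurd (hG (h.le.trans (le_max_left X 1))) (not_le.2 (hz.2.trans_lt hyX))

open Real Set Topology in
lemma tendsto_div_apply_sInf_le {G : ℝ → ℝ} (hG : Antitone G) (hpos : ∀ x > 0, 0 < G x)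
    (h0 : Tendsto G atTop (𝓝 0)) {α : ℝ}
    (hrv : ∀ c > 0, Tendsto (fun x => G (c * x) / G x) atTop (𝓝 (c ^ (-α)))) :
    Tendsto (fun y => y / G (sInf {x : ℝ | 0 ≤ x ∧ G x ≤ y})) (𝓝[>] 0) (𝓝 1) := by
  have ha := tendsto_sInf_le_atTop hG hpos h0
  set a : ℝ → ℝ := fun y => sInf {x : ℝ | 0 ≤ x ∧ G x ≤ y} with hadef
  have hcont : Tendsto (fun c : ℝ => c ^ (-α)) (𝓝 1) (𝓝 1) := by
    simpa using (continuousAt_rpow_const (1 : ℝ) (-α) (Or.inl one_ne_zero)).tendsto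
  have hlow : ∀ c > 1, ∀ᶠ y in 𝓝[>] 0, G (c * a y) / G (a y) ≤ y / G (a y) := by
    intro c hc
    filter_upwards [self_mem_nhdsWithin, ha.eventually_gt_atTop 0] with y hy hay
    obtain ⟨x, hx⟩ := ((h0.eventually_le_const hy).and (eventually_ge_atTop 0)).exists
    have hne : {x : ℝ | 0 ≤ x ∧ G x ≤ y}.Nonempty := ⟨x, hx.2, hx.1⟩
    obtain ⟨z, hz, hzc⟩ := exists_lt_of_csInf_lt hne
      (show sInf {x : ℝ | 0 ≤ x ∧ G x ≤ y} < c * a y from lt_mul_of_one_lt_left hay hc)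
    have := hpos _ hay
    gcongr
    exact (hG hzc.le).trans hz.2
  have hup : ∀ c > 0, c < 1 → ∀ᶠ y in 𝓝[>] 0, y / G (a y) ≤ G (c * a y) / G (a y) := by
    intro c hc0 hc
    filter_upwards [ha.eventually_gt_atTop 0] with y hay
    have := hpos _ hay
    gcongr
    by_contra! h
    have hbdd : BddBelow {x : ℝ | 0 ≤ x ∧ G x ≤ y} := ⟨0, fun z hz => hz.1⟩
    have hmem : c * a y ∈ {x : ℝ | 0 ≤ x ∧ G x ≤ y} := ⟨by positivity, h.le⟩
    exact absurd (csInf_le hbdd hmem) (not_le.2 (mul_lt_of_lt_one_left hay hc))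
  rw [tendsto_order]
  constructor
  · intro l hl
    obtain ⟨c, hcl, hc⟩ := (((hcont.eventually_const_lt hl).filter_mono nhdsWithin_le_nhds).and
      (self_mem_nhdsWithin (s := Ioi (1 : ℝ)))).exists
    filter_upwards [hlow c hc,
      ((hrv c (zero_lt_one.trans hc)).comp ha).eventually_const_lt hcl] with y h1 h2
    exact h2.trans_le h1
  · intro r hr
    obtain ⟨c, ⟨hcr, hc0⟩, hc⟩ := ((((hcont.eventually_lt_const hr).and
      (eventually_gt_nhds zero_lt_one)).filter_mono nhdsWithin_le_nhds).and
      (self_mem_nhdsWithin (s := Iio (1 : ℝ)))).exists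
    filter_upwards [hup c hc0 hc, ((hrv c hc0).comp ha).eventually_lt_const hcr] with y h1 h2
    exact h1.trans_lt h2

open Real Set Topology in
lemma tendsto_measureReal_Ici_atTop (μ : Measure ℝ) [IsFiniteMeasure μ] :
    Tendsto (fun x => μ.real (Ici x)) atTop (𝓝 0) := by
  have h1 : Tendsto (fun n : ℕ => μ.real (Ici (n : ℝ))) atTop (𝓝 0) := by
    have h := tendsto_measure_iInter_atTop (μ := μ) (s := fun n : ℕ => Ici (n : ℝ))
      (fun n => measurableSet_Ici.nullMeasurableSet)
      (fun m n hmn => Ici_subset_Ici.2 (by exact_mod_cast hmn)) ⟨0, measure_ne_top _ _⟩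
    have he : ⋂ n : ℕ, Ici (n : ℝ) = ∅ := by
      refine eq_empty_of_forall_notMem fun x hx => ?_
      obtain ⟨n, hn⟩ := exists_nat_gt x
      exact absurd (mem_iInter.1 hx n) (not_le.2 hn)
    rw [he, measure_empty] at h
    exact (ENNReal.tendsto_toReal ENNReal.zero_ne_top).comp h
  refine squeeze_zero' (Eventually.of_forall fun x => measureReal_nonneg) ?_
    (h1.comp tendsto_nat_floor_atTop)
  filter_upwards [eventually_ge_atTop 0] with x hx
  exact measureReal_mono (Ici_subset_Ici.2 (Nat.floor_le hx))

open Real Set Topology in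
lemma zero_sub_eq_two_mul_integral_one_sub_cos (μ : Measure ℝ) [IsFiniteMeasure μ]
    (hsymm : μ.map (fun x => -x) = μ) {R : ℝ → ℝ}
    (hR : ∀ t : ℝ, (R t : ℂ) = ∫ x : ℝ, Complex.exp (Complex.I * t * x) ∂μ) (s : ℝ) :
    R 0 - R s = 2 * ∫ x, (1 - cos (max 0 (|s| * x))) ∂μ := by
  have hI : ∀ g : ℝ → ℝ, Continuous g → Integrable (fun x => cos (g x)) μ := fun g hg =>
    Integrable.of_bound (Continuous.aestronglyMeasurable (by fun_prop)) 1
      (ae_of_all _ fun x => abs_cos_le_one _)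
  have hcos : ∀ t, R t = ∫ x, cos (t * x) ∂μ := by
    intro t
    have hfint : Integrable (fun x : ℝ => Complex.exp (Complex.I * t * x)) μ := by
      refine Integrable.of_bound (Continuous.aestronglyMeasurable (by fun_prop)) 1
        (ae_of_all _ fun x => ?_)
      rw [Complex.norm_exp]
      simp
    have h1 := congrArg Complex.re (hR t)
    rw [Complex.ofReal_re, ← RCLike.re_eq_complex_re, ← integral_re hfint] at h1
    rw [h1]
    refine integral_congr_ae (ae_of_all _ fun x => ?_)
    simp [Complex.exp_re]
  have hneg : ∫ x, (1 - cos (max 0 (|s| * x))) ∂μ = ∫ x, (1 - cos (max 0 (|s| * -x))) ∂μ := by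
    conv_lhs => rw [← hsymm]
    exact integral_map (by fun_prop) (Continuous.aestronglyMeasurable (by fun_prop))
  have hI' : ∀ g : ℝ → ℝ, Continuous g → Integrable (fun x => 1 - cos (g x)) μ := fun g hg =>
    (integrable_const 1).sub (hI g hg)
  rw [two_mul]
  nth_rewrite 2 [hneg]
  rw [hcos, hcos, ← integral_sub (hI _ (by fun_prop)) (hI _ (by fun_prop)),
    ← integral_add (hI' _ (by fun_prop)) (hI' _ (by fun_prop))]
  refine integral_congr_ae (ae_of_all _ fun x => ?_)
  have h1 : cos (s * x) = cos (|s| * x) := by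
    rcases abs_choice s with h | h <;> rw [h]
    rw [neg_mul, cos_neg]
  simp only [h1, zero_mul, cos_zero, mul_neg]
  rcases le_total 0 (|s| * x) with h | h
  · rw [max_eq_right h, max_eq_left (by linarith)]; simp
  · rw [max_eq_left h, max_eq_right (by linarith)]; simp

/-- for each fixed `t ≠ 0`,
`√(R(0) - R(t δ_u)) ~ C_α^{1/2} |t|^{α/2} u⁻¹` as `u → ∞`. -/
theorem excursion_stmt9
    (α : ℝ) (hα0 : 0 < α) (hα2 : α < 2)
    (μ : Measure ℝ) [IsFiniteMeasure μ]
    (hμ_nonnull : μ Set.univ ≠ 0)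
    (hμ_symm : μ.map (fun x => -x) = μ)
    (hμ_tail_pos : ∀ x > (0 : ℝ), 0 < μ (Set.Ici x))
    (hμ_rv : ∀ c > (0 : ℝ),
      Tendsto (fun x : ℝ => (μ (Set.Ici (c * x))).toReal / (μ (Set.Ici x)).toReal)
        atTop (nhds (c ^ (-α))))
    (R : ℝ → ℝ)
    (hR : ∀ t : ℝ, (R t : ℂ) = ∫ x : ℝ, Complex.exp (Complex.I * t * x) ∂μ)
    (h : ℝ → ℝ)
    (hh : ∀ y : ℝ, h y = sInf {x : ℝ | 0 ≤ x ∧ (μ (Set.Ici x)).toReal ≤ y})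
    (δ : ℝ → ℝ)
    (hδ : ∀ u : ℝ, δ u = (h (u ^ (-2 : ℝ)))⁻¹) :
    ∀ t : ℝ, t ≠ 0 →
      Tendsto (fun u : ℝ =>
          Real.sqrt (R 0 - R (t * δ u)) /
            (Real.sqrt (Real.pi / (Real.Gamma α * Real.sin (Real.pi * α / 2)))
              * |t| ^ (α / 2) * u⁻¹))
        atTop (nhds 1) := by
  have hrv : ∀ c > (0 : ℝ), Tendsto
      (fun x : ℝ => μ.real (Set.Ici (c * x)) / μ.real (Set.Ici x)) atTop (nhds (c ^ (-α))) := hμ_rv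
  set G : ℝ → ℝ := fun x => μ.real (Set.Ici x) with hGdef
  have hG : Antitone G := fun x y hxy => measureReal_mono (Set.Ici_subset_Ici.2 hxy)
  have hpos : ∀ x > (0 : ℝ), 0 < G x := fun x hx =>
    ENNReal.toReal_pos (hμ_tail_pos x hx).ne' (measure_ne_top _ _)
  have hG0 : Tendsto G atTop (nhds 0) := tendsto_measureReal_Ici_atTop μ
  have hy : Tendsto (fun u : ℝ => u ^ (-2 : ℝ)) atTop (nhdsWithin 0 (Set.Ioi 0)) :=
    tendsto_nhdsWithin_iff.2 ⟨tendsto_rpow_neg_atTop two_pos, by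
      filter_upwards [eventually_gt_atTop 0] with u hu
      exact Real.rpow_pos_of_pos hu _⟩
  have hheq : h = fun y => sInf {x : ℝ | 0 ≤ x ∧ G x ≤ y} := funext hh
  have ha : Tendsto (fun u : ℝ => h (u ^ (-2 : ℝ))) atTop atTop := by
    rw [hheq]
    exact (tendsto_sInf_le_atTop hG hpos hG0).comp hy
  have hya : Tendsto (fun u : ℝ => u ^ (-2 : ℝ) / G (h (u ^ (-2 : ℝ)))) atTop (nhds 1) := by
    rw [hheq]
    exact (tendsto_div_apply_sInf_le hG hpos hG0 hrv).comp hy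
  intro t ht
  have ht0 : 0 < |t| := abs_pos.2 ht
  have hΓ := Real.Gamma_pos_of_pos hα0
  have hsin : 0 < Real.sin (Real.pi * α / 2) :=
    Real.sin_pos_of_pos_of_lt_pi (by positivity) (by nlinarith [Real.pi_pos])
  set D := Real.Gamma α * Real.sin (Real.pi * α / 2) with hD
  have hD0 : 0 < D := mul_pos hΓ hsin
  have hmain := (tendsto_integral_one_sub_cos_div_tail hα0 hα2 μ hpos hrv).comp
    (ha.const_mul_atTop (inv_pos.2 ht0))
  have hscale := (hrv |t|⁻¹ (inv_pos.2 ht0)).comp ha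
  have hlim := ((hmain.mul hscale).div hya one_ne_zero).const_mul (2 * (D / Real.pi) * |t| ^ (-α))
  have hval : 2 * (D / Real.pi) * |t| ^ (-α) *
      (Real.pi / (2 * D) * |t|⁻¹ ^ (-α) / 1) = 1 := by
    have h1 : |t| ^ (-α) * |t|⁻¹ ^ (-α) = 1 := by
      rw [Real.inv_rpow ht0.le, mul_inv_cancel₀ (Real.rpow_pos_of_pos ht0 _).ne']
    have hpi := Real.pi_pos
    calc _ = (2 * (D / Real.pi) * (Real.pi / (2 * D))) * (|t| ^ (-α) * |t|⁻¹ ^ (-α)) := by ring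
      _ = 1 := by rw [h1]; field_simp
  rw [hval] at hlim
  have hsqrt := hlim.sqrt
  rw [Real.sqrt_one] at hsqrt
  refine hsqrt.congr' ?_
  filter_upwards [ha.eventually_gt_atTop 0, eventually_gt_atTop 0] with u hau hu
  set a := h (u ^ (-2 : ℝ)) with hadef
  have hGa := hpos a hau
  have hGb := hpos (|t|⁻¹ * a) (by positivity)
  have hden : Real.sqrt (Real.pi / D) * |t| ^ (α / 2) * u⁻¹ =
      Real.sqrt (Real.pi / D * |t| ^ α * u ^ (-2 : ℝ)) := by
    rw [Real.sqrt_mul (by positivity), Real.sqrt_mul (by positivity)]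
    congr 2
    · rw [Real.sqrt_eq_rpow, ← Real.rpow_mul ht0.le]
      ring_nf
    · rw [Real.sqrt_eq_rpow, ← Real.rpow_mul hu.le, ← Real.rpow_neg_one]
      norm_num
  have hu2 : 0 < u ^ (-2 : ℝ) := Real.rpow_pos_of_pos hu _
  have htα : 0 < |t| ^ α := Real.rpow_pos_of_pos ht0 _
  rw [hden, ← Real.sqrt_div' _ (by positivity), zero_sub_eq_two_mul_integral_one_sub_cos μ hμ_symm hR]
  congr 1
  have harg : ∀ x : ℝ, |t * δ u| * x = x / (|t|⁻¹ * a) := by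
    intro x
    rw [hδ, abs_mul, abs_inv, abs_of_pos hau]
    field_simp
  simp_rw [harg]
  simp only [Function.comp_apply, Pi.div_apply, ← hadef, hGdef] at hGa hGb ⊢
  rw [Real.rpow_neg ht0.le]
  have hpi := Real.pi_pos
  generalize μ.real (Set.Ici (|t|⁻¹ * a)) = g at hGb ⊢
  generalize ∫ x, (1 - Real.cos (max 0 (x / (|t|⁻¹ * a)))) ∂μ = I
  field_simp
end
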